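/- Let (C_{φ_t})_{t≥0} be an immediately compact analytic semigroup of composition operators on H²(𝔻) or the Dirichlet space 𝒟. Then the following are equivalent: (1) there exists t₀ > 0 with ‖φ_{t₀}‖_∞ < 1; (2) ‖φ_t‖_∞ < 1 for all t > 0. Consequently, if ‖φ_{t₀}‖_∞ < 1 for some t₀ > 0 then (C_{φ_t})_{t≥0} is immediately trace-class. -/

import Mathlib

open Complex MeasureTheory Filter Set Metric
open scoped Real Topology ENNReal

noncomputable section

/-- The weighted Hardy space `H²(β)`, modeled as the `ℓ²` space of weighted
Taylor coefficient sequences: the function `f(z) = Σ cₙ zⁿ` corresponds to the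
square-summable sequence `(cₙ βₙ)ₙ`. -/
abbrev WH2 : Type := lp (fun _ : ℕ => ℂ) 2

/-- The analytic function on the unit disc associated to an element of `H²(β)`. -/
def wToFun (β : ℕ → ℝ) (f : WH2) (z : ℂ) : ℂ := ∑' n : ℕ, (f n / (β n : ℂ)) * z ^ n

/-- The open unit disc. -/
def uDisc : Set ℂ := Metric.ball 0 1

/-- Weights of the classical Hardy space `H²(𝔻)` (`βₙ = 1`). -/
def hardyW : ℕ → ℝ := fun _ => 1

/-- Weights of the Dirichlet space `𝒟` (`β₀ = 1`, `βₙ = √n`). -/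
def dirichletW : ℕ → ℝ := fun n => if n = 0 then 1 else Real.sqrt n

/-- The monomial `eₙ(z) = zⁿ` as an element of `H²(β)`. -/
def eW (β : ℕ → ℝ) (n : ℕ) : WH2 := lp.single 2 n ((β n : ℝ) : ℂ)

/-- `T` acts as the composition operator with analytic self-map symbol `φ` on `H²(β)`. -/
def RepresentsComp (β : ℕ → ℝ) (T : WH2 →L[ℂ] WH2) (φ : ℂ → ℂ) : Prop :=
  DifferentiableOn ℂ φ uDisc ∧ MapsTo φ uDisc uDisc ∧
  ∀ f : WH2, ∀ z ∈ uDisc, wToFun β (T f) z = wToFun β f (φ z)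

/-- `T` is a composition operator on `H²(β)`. -/
def IsCompositionOperator (β : ℕ → ℝ) (T : WH2 →L[ℂ] WH2) : Prop :=
  ∃ φ : ℂ → ℂ, RepresentsComp β T φ

/-- `T` is a weighted composition operator `f ↦ w · (f ∘ φ)` on `H²(𝔻)`. -/
def IsWeightedCompOp (T : WH2 →L[ℂ] WH2) : Prop :=
  ∃ w φ : ℂ → ℂ, DifferentiableOn ℂ w uDisc ∧ DifferentiableOn ℂ φ uDisc ∧
    MapsTo φ uDisc uDisc ∧
    ∀ f : WH2, ∀ z ∈ uDisc, wToFun hardyW (T f) z = w z * wToFun hardyW f (φ z)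

section Semigroup

variable {X : Type*} [NormedAddCommGroup X] [NormedSpace ℂ X]

/-- `T` is a `C₀`-semigroup (indexed by `t ≥ 0`). -/
def IsC0Semigroup (T : ℝ → X →L[ℂ] X) : Prop :=
  T 0 = 1 ∧ (∀ s t : ℝ, 0 ≤ s → 0 ≤ t → T (s + t) = (T s).comp (T t)) ∧
  ∀ x : X, Tendsto (fun t : ℝ => T t x) (𝓝[≥] 0) (𝓝 x)

/-- `T` is a `C₀`-group (indexed by `t ∈ ℝ`). -/
def IsC0Group (T : ℝ → X →L[ℂ] X) : Prop :=
  T 0 = 1 ∧ (∀ s t : ℝ, T (s + t) = (T s).comp (T t)) ∧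
  ∀ x : X, Tendsto (fun t : ℝ => T t x) (𝓝 0) (𝓝 x)

/-- Quasicontractive: `‖T(t)‖ ≤ e^{wt}` for some `w ≥ 0` and all `t ≥ 0`. -/
def Quasicontractive (T : ℝ → X →L[ℂ] X) : Prop :=
  ∃ w : ℝ, 0 ≤ w ∧ ∀ t : ℝ, 0 ≤ t → ‖T t‖ ≤ Real.exp (w * t)

/-- The sector `Σ_θ = {re^{iα} : r ≥ 0, |α| < θ}` (note `arg 0 = 0`). -/
def Sector (θ : ℝ) : Set ℂ := {z : ℂ | |Complex.arg z| < θ}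

/-- `Te` is an analytic extension of the semigroup `T` to the sector `Σ_θ`,
bounded on `Σ_θ ∩ 𝔻`. -/
def IsAnalyticExtension (T : ℝ → X →L[ℂ] X) (θ : ℝ) (Te : ℂ → X →L[ℂ] X) : Prop :=
  (∀ t : ℝ, 0 ≤ t → Te t = T t) ∧
  DifferentiableOn ℂ Te (Sector θ \ {0}) ∧
  ∃ M : ℝ, ∀ ξ ∈ Sector θ, ‖ξ‖ < 1 → ‖Te ξ‖ ≤ M

/-- The semigroup `T` extends analytically and boundedly to the sector `Σ_θ`. -/
def HasAnalyticExtension (T : ℝ → X →L[ℂ] X) (θ : ℝ) : Prop :=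
  ∃ Te : ℂ → X →L[ℂ] X, IsAnalyticExtension T θ Te

/-- The semigroup `T` is analytic (on some sector `Σ_θ`, `θ ∈ (0, π/2]`). -/
def IsAnalyticSemigroup (T : ℝ → X →L[ℂ] X) : Prop :=
  ∃ θ ∈ Set.Ioc 0 (π / 2), HasAnalyticExtension T θ

/-- `y` is the limit of `(T(t)x - x)/t` as `t → 0⁺`. -/
def GenLimit (T : ℝ → X →L[ℂ] X) (x y : X) : Prop :=
  Tendsto (fun t : ℝ => (t : ℂ)⁻¹ • (T t x - x)) (𝓝[>] 0) (𝓝 y)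

/-- `A`, with domain `D`, is the infinitesimal generator of the semigroup `T`. -/
def IsGenerator (T : ℝ → X →L[ℂ] X) (D : Set X) (A : X → X) : Prop :=
  (∀ x ∈ D, GenLimit T x (A x)) ∧ ∀ x : X, (∃ y, GenLimit T x y) → x ∈ D

/-- `y` is the two-sided limit of `(T(t)x - x)/t` as `t → 0` (for groups). -/
def GenLimitGrp (T : ℝ → X →L[ℂ] X) (x y : X) : Prop :=
  Tendsto (fun t : ℝ => (t : ℂ)⁻¹ • (T t x - x)) (𝓝[≠] 0) (𝓝 y)

/-- `A`, with domain `D`, is the infinitesimal generator of the group `T`. -/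
def IsGeneratorGrp (T : ℝ → X →L[ℂ] X) (D : Set X) (A : X → X) : Prop :=
  (∀ x ∈ D, GenLimitGrp T x (A x)) ∧ ∀ x : X, (∃ y, GenLimitGrp T x y) → x ∈ D

/-- Immediately compact semigroup: `T(t)` is compact for all `t > 0`. -/
def ImmediatelyCompact (T : ℝ → X →L[ℂ] X) : Prop :=
  ∀ t : ℝ, 0 < t → IsCompactOperator (T t)

/-- Eventually compact semigroup: `T(t)` is compact for all `t ≥ t₀`, some `t₀ > 0`. -/
def EventuallyCompact (T : ℝ → X →L[ℂ] X) : Prop :=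
  ∃ t₀ : ℝ, 0 < t₀ ∧ ∀ t : ℝ, t₀ ≤ t → IsCompactOperator (T t)

end Semigroup

/-- The natural domain of the operator `A f = G f'` in `H²(β)`: those `f` for which
`G · (wToFun β f)'` is realized by some element of `H²(β)`. -/
def domA (β : ℕ → ℝ) (G : ℂ → ℂ) : Set WH2 :=
  {f : WH2 | ∃ g : WH2, ∀ z ∈ uDisc, wToFun β g z = G z * deriv (wToFun β f) z}

open Classical in
/-- The operator `A f = G f'` on `H²(β)` (defined via choice on its natural domain). -/
def opA (β : ℕ → ℝ) (G : ℂ → ℂ) (f : WH2) : WH2 :=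
  if h : f ∈ domA β G then h.choose else 0

/-- `(φ_t)_{t ≥ 0}` is a (jointly continuous) semiflow of analytic self-maps of `𝔻`. -/
def IsSemiflow (φ : ℝ → ℂ → ℂ) : Prop :=
  (∀ z ∈ uDisc, φ 0 z = z) ∧
  (∀ t : ℝ, 0 ≤ t → DifferentiableOn ℂ (φ t) uDisc ∧ MapsTo (φ t) uDisc uDisc) ∧
  (∀ s t : ℝ, 0 ≤ s → 0 ≤ t → ∀ z ∈ uDisc, φ (s + t) z = φ s (φ t z)) ∧
  ContinuousOn (fun p : ℝ × ℂ => φ p.1 p.2) (Set.Ici 0 ×ˢ uDisc)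

/-- `G` is the infinitesimal generator of the semiflow `φ`: `∂φ_t/∂t = G ∘ φ_t`. -/
def SemiflowGenerator (φ : ℝ → ℂ → ℂ) (G : ℂ → ℂ) : Prop :=
  ∀ z ∈ uDisc, ∀ t : ℝ, 0 ≤ t → HasDerivAt (fun s : ℝ => φ s z) (G (φ t z)) t

/-- Hilbert–Schmidt operator on `WH2` (w.r.t. the standard orthonormal basis). -/
def IsHilbertSchmidt (T : WH2 →L[ℂ] WH2) : Prop :=
  Summable (fun n : ℕ => ‖T (lp.single 2 n (1 : ℂ))‖ ^ 2)

/-- Trace-class operator on `WH2`: a product of two Hilbert–Schmidt operators. -/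
def IsTraceClass (T : WH2 →L[ℂ] WH2) : Prop :=
  ∃ A B : WH2 →L[ℂ] WH2, IsHilbertSchmidt A ∧ IsHilbertSchmidt B ∧ T = A.comp B

/-- `‖φ‖_∞ < 1` for a function on the unit disc. -/
def SupNormLtOne (φ : ℂ → ℂ) : Prop :=
  ∃ r : ℝ, r < 1 ∧ ∀ z ∈ uDisc, ‖φ z‖ ≤ r

/-- Essential boundary condition via radial limits: for almost every boundary point
`ξ = e^{it}`, whenever the radial limit `L` of `G` at `ξ` exists,
`Re (e^{iα} ξ̄ L) ≤ c`.  (This encodes `ess sup_(z ∈ 𝕋) Re (e^{iα} z̄ G(z)) ≤ c`.) -/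
def BoundaryReLe (G : ℂ → ℂ) (α : ℝ) (c : ℝ) : Prop :=
  ∀ᵐ t : ℝ, ∀ L : ℂ,
    Tendsto (fun r : ℝ => G ((r : ℂ) * Complex.exp ((t : ℂ) * Complex.I)))
      (𝓝[<] 1) (𝓝 L) →
    (Complex.exp ((α : ℂ) * Complex.I) *
      (starRingEnd ℂ) (Complex.exp ((t : ℂ) * Complex.I)) * L).re ≤ c

/-- `Re (z̄ G(z)) = 0` almost everywhere on the unit circle, via radial limits. -/
def BoundaryReEqZero (G : ℂ → ℂ) : Prop :=
  ∀ᵐ t : ℝ, ∀ L : ℂ,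
    Tendsto (fun r : ℝ => G ((r : ℂ) * Complex.exp ((t : ℂ) * Complex.I)))
      (𝓝[<] 1) (𝓝 L) →
    ((starRingEnd ℂ) (Complex.exp ((t : ℂ) * Complex.I)) * L).re = 0

end

/-- `f` is the sum on the unit disc of the power series with coefficients `a`. -/
def IsDiscSeries (a : ℕ → ℂ) (f : ℂ → ℂ) : Prop :=
  ∀ z ∈ uDisc, HasSum (fun k : ℕ => a k * z ^ k) (f z)

theorem mem_uDisc {z : ℂ} : z ∈ uDisc ↔ ‖z‖ < 1 := mem_ball_zero_iff

theorem IsDiscSeries.hasFPowerSeriesOnBall {a : ℕ → ℂ} {f : ℂ → ℂ} (h : IsDiscSeries a f) :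
    HasFPowerSeriesOnBall f (FormalMultilinearSeries.ofScalars ℂ a) 0 1 := by
  refine ⟨?_, one_pos, fun {z} hz => ?_⟩
  · refine ENNReal.le_of_forall_nnreal_lt fun r hr => ?_
    have hr1 : (r : ℝ) < 1 := by exact_mod_cast hr
    apply FormalMultilinearSeries.le_radius_of_summable_norm
    have := (h (r : ℂ) (mem_uDisc.2 (by simpa using hr1))).summable.norm
    simpa using this
  · have hz' : z ∈ uDisc := by
      rwa [← ENNReal.ofReal_one, Metric.eball_ofReal] at hz
    simpa [FormalMultilinearSeries.ofScalars_apply_eq, mul_comm] using h z hz'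

theorem IsDiscSeries.deriv {a : ℕ → ℂ} {f : ℂ → ℂ} (h : IsDiscSeries a f) :
    IsDiscSeries (fun k => (k + 1 : ℂ) * a (k + 1)) (deriv f) := by
  have hp := h.hasFPowerSeriesOnBall
  have hcoeff : ∀ n, a n = iteratedDeriv n f 0 / n.factorial := congrFun
    (FormalMultilinearSeries.ofScalars_series_injective ℂ ℂ
      (hp.hasFPowerSeriesAt.eq_formalMultilinearSeries hp.analyticAt.hasFPowerSeriesAt))
  have hd : DifferentiableOn ℂ f (ball 0 1) := by
    have := hp.differentiableOn
    rwa [← ENNReal.ofReal_one, Metric.eball_ofReal] at this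
  intro z hz
  refine (hasSum_taylorSeries_on_ball (hd.deriv isOpen_ball) hz).congr_fun fun k => ?_
  simp only [hcoeff]
  rw [← iteratedDeriv_succ', Nat.factorial_succ]
  have : (k.factorial : ℂ) ≠ 0 := by exact_mod_cast k.factorial_ne_zero
  have : (k + 1 : ℂ) ≠ 0 := by exact_mod_cast k.succ_ne_zero
  push_cast
  simp only [sub_zero, smul_eq_mul]
  field_simp

/-- Parseval comparison on circles: pointwise domination of power series in the disc implies
domination of their square means. -/
theorem IsDiscSeries.hasSum_sq_le {a b : ℕ → ℂ} {f g : ℂ → ℂ} (hf : IsDiscSeries a f)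
    (hg : IsDiscSeries b g) {C : ℝ} (hle : ∀ z ∈ uDisc, ‖g z‖ ≤ C * ‖f z‖)
    {s : ℝ} (hs : 0 ≤ s) (hs1 : s < 1) :
    ∃ A B : ℝ, HasSum (fun k => ‖a k‖ ^ 2 * (s ^ 2) ^ k) A ∧
      HasSum (fun k => ‖b k‖ ^ 2 * (s ^ 2) ^ k) B ∧ B ≤ C ^ 2 * A := by
  have hsd : (s : ℂ) ∈ uDisc := mem_uDisc.2 (by simpa [abs_of_nonneg hs] using hs1)
  have hcirc : ∀ x : AddCircle (1 : ℝ), (s : ℂ) * fourier 1 x ∈ uDisc := fun x => by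
    rw [mem_uDisc, fourier_apply, norm_mul, Circle.norm_coe, norm_real, Real.norm_of_nonneg hs,
      mul_one]
    exact hs1
  have key : ∀ {c : ℕ → ℂ} {u : ℂ → ℂ}, IsDiscSeries c u →
      ∃ F : Lp ℂ 2 (AddCircle.haarAddCircle (T := 1)),
        HasSum (fun k => ‖c k‖ ^ 2 * (s ^ 2) ^ k) (‖F‖ ^ 2) ∧
        ∀ᵐ x ∂(AddCircle.haarAddCircle (T := 1)), F x = u (s * fourier 1 x) := by
    intro c u hu
    have hsum : Summable fun k : ℕ => (c k * s ^ k) • (fourier (T := 1) (k : ℤ)) := by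
      refine Summable.of_norm ?_
      simpa only [norm_smul, norm_mul, fourier_norm, mul_one] using (hu s hsd).summable.norm
    obtain ⟨G, hG⟩ := hsum
    have hL := hG.mapL (ContinuousMap.toLp (E := ℂ) 2 (AddCircle.haarAddCircle (T := 1)) ℂ)
    refine ⟨ContinuousMap.toLp (E := ℂ) 2 AddCircle.haarAddCircle ℂ G, ?_, ?_⟩
    · have h2 := (continuous_norm.pow 2).tendsto _ |>.comp hL
      refine (h2.congr fun t => ?_ : Tendsto _ _ _)
      have hv : Orthonormal ℂ fun k : ℕ => fourierLp (T := 1) 2 (k : ℤ) :=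
        orthonormal_fourier.comp _ Nat.cast_injective
      have := hv.orthogonalFamily.norm_sum (fun k : ℕ => c k * (s : ℂ) ^ k) t
      simp only [LinearIsometry.toSpanSingleton_apply] at this
      simp only [Function.comp, map_smul, Pi.pow_apply]
      refine this.trans (Finset.sum_congr rfl fun k _ => ?_)
      rw [norm_mul, norm_pow, norm_real, Real.norm_of_nonneg hs]
      ring
    · filter_upwards [ContinuousMap.coeFn_toLp (p := 2) (𝕜 := ℂ)
        (AddCircle.haarAddCircle (T := 1)) G] with x hx
      rw [hx]
      have hx' := hG.mapL (ContinuousMap.evalCLM ℂ x)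
      refine hx'.unique ?_
      convert hu _ (hcirc x) using 2 with k
      simp [mul_pow, mul_assoc, AddCircle.toCircle_nsmul, fourier_apply]
  obtain ⟨F, hF, hFx⟩ := key hf
  obtain ⟨G, hG, hGx⟩ := key hg
  refine ⟨_, _, hF, hG, ?_⟩
  rw [← mul_pow]
  gcongr
  refine Lp.norm_le_mul_norm_of_ae_le_mul ?_
  filter_upwards [hFx, hGx] with x h1 h2
  rw [h1, h2]
  exact hle _ (hcirc x)

/-- Integrating a comparison of power series over `(0, 1)`. -/
theorem sum_div_succ_le {c d : ℕ → ℝ} (hc : ∀ k, 0 ≤ c k) (hd : ∀ k, 0 ≤ d k) {C : ℝ}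
    (hC : 0 ≤ C)
    (h : ∀ x ∈ Ioo (0 : ℝ) 1, ∃ A B : ℝ, HasSum (fun k => d k * x ^ k) A ∧
      HasSum (fun k => c k * x ^ k) B ∧ B ≤ C * A)
    {D : ℝ} (hD : HasSum (fun k : ℕ => d k / (k + 1)) D) :
    ∃ B : ℝ, HasSum (fun k : ℕ => c k / (k + 1)) B ∧ B ≤ C * D := by
  have hint : ∀ {e : ℝ} (k : ℕ), 0 ≤ e →
      ∫⁻ x in Ioo (0 : ℝ) 1, ENNReal.ofReal (e * x ^ k) = ENNReal.ofReal (e / (k + 1)) := by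
    intro e k he
    rw [← ofReal_integral_eq_lintegral_ofReal]
    · rw [← integral_Ioc_eq_integral_Ioo, ← intervalIntegral.integral_of_le zero_le_one]
      simp [integral_pow, div_eq_mul_inv]
    · exact (Continuous.integrableOn_Icc (by fun_prop)).mono_set Ioo_subset_Icc_self
    · filter_upwards [ae_restrict_mem measurableSet_Ioo] with x hx
      have := hx.1.le
      positivity
  have htot : ∀ {e : ℕ → ℝ}, (∀ k, 0 ≤ e k) →
      ∑' k : ℕ, ENNReal.ofReal (e k / (k + 1)) =
        ∫⁻ x in Ioo (0 : ℝ) 1, ∑' k : ℕ, ENNReal.ofReal (e k * x ^ k) := by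
    intro e he
    rw [lintegral_tsum fun k => by fun_prop]
    exact tsum_congr fun k => (hint k (he k)).symm
  have hle : ∑' k : ℕ, ENNReal.ofReal (c k / (k + 1)) ≤ ENNReal.ofReal (C * D) := by
    rw [ENNReal.ofReal_mul hC, ← hD.tsum_eq,
      ENNReal.ofReal_tsum_of_nonneg (fun k => div_nonneg (hd k) (by positivity)) hD.summable,
      htot hc, htot hd, ← lintegral_const_mul _ (by fun_prop)]
    refine setLIntegral_mono' measurableSet_Ioo fun x hx => ?_
    obtain ⟨A, B, hA, hB, hAB⟩ := h x hx
    rw [← ENNReal.ofReal_tsum_of_nonneg (fun k => mul_nonneg (hc k) (pow_nonneg hx.1.le k))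
      hB.summable, ← ENNReal.ofReal_tsum_of_nonneg
        (fun k => mul_nonneg (hd k) (pow_nonneg hx.1.le k)) hA.summable, hA.tsum_eq, hB.tsum_eq,
      ← ENNReal.ofReal_mul hC]
    exact ENNReal.ofReal_le_ofReal hAB
  have hsum : Summable fun k : ℕ => c k / ((k : ℝ) + 1) := by
    have := ENNReal.summable_toReal (hle.trans_lt ENNReal.ofReal_lt_top).ne
    refine this.congr fun k => ENNReal.toReal_ofReal (div_nonneg (hc k) (by positivity))
  refine ⟨_, hsum.hasSum, ?_⟩
  have hD0 : 0 ≤ D := hD.nonneg fun k => div_nonneg (hd k) (by positivity)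
  rwa [← ENNReal.ofReal_tsum_of_nonneg (fun k => div_nonneg (hc k) (by positivity)) hsum,
    ENNReal.ofReal_le_ofReal_iff (mul_nonneg hC hD0)] at hle

/-- A Harnack-type consequence of the Borel-Carathéodory inequality. -/
theorem one_sub_norm_le_two_mul {f : ℂ → ℂ} {c w : ℂ} {R : ℝ} (hR : 0 < R)
    (hf : DifferentiableOn ℂ f (ball c R)) (hb : ∀ x ∈ ball c R, ‖f x‖ ≤ 1)
    (hw : ‖w - c‖ ≤ R / 4) : 1 - ‖f c‖ ≤ 2 * (1 - ‖f w‖) := by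
  obtain ⟨ω, hω, hωw⟩ : ∃ ω : ℂ, ‖ω‖ = 1 ∧ ω * f w = ‖f w‖ := by
    refine ⟨exp (-(arg (f w) : ℂ) * I), ?_, ?_⟩
    · rw [norm_exp]; simp
    · conv_lhs => rw [← norm_mul_exp_arg_mul_I (f w)]
      rw [mul_left_comm, ← exp_add]
      simp
  have hsub : ∀ y ∈ ball (0 : ℂ) (3 * R / 4), w + y ∈ ball c R := by
    intro y hy
    rw [mem_ball_zero_iff] at hy
    rw [mem_ball_iff_norm]
    calc ‖w + y - c‖ = ‖(w - c) + y‖ := by ring_nf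
      _ ≤ ‖w - c‖ + ‖y‖ := norm_add_le _ _
      _ < R := by linarith
  have hre : ∀ x ∈ ball c R, (ω * f x).re ≤ 1 := fun x hx =>
    (re_le_norm _).trans (by rw [norm_mul, hω, one_mul]; exact hb x hx)
  refine le_of_forall_pos_le_add fun ε hε => ?_
  have hcw : ‖c - w‖ ≤ R / 4 := by rwa [norm_sub_rev]
  have key := borelCaratheodory (f := fun y => ω * f (w + y) - 1) (M := ε) (R := 3 * R / 4)
    (z := c - w) hε
    ((((hf.comp (by fun_prop) fun y hy => hsub y hy).const_mul ω).sub_const 1))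
    (fun y hy => by
      have := hre _ (hsub y hy)
      simp only [mem_ofPred_eq, sub_re, one_re]
      linarith) (by positivity) (by rw [mem_ball_zero_iff]; linarith)
  have hw1 : ‖f w‖ ≤ 1 := by
    have := hb _ (hsub 0 (by simp; positivity))
    simpa using this
  have h0 : ‖ω * f (w + 0) - 1‖ = 1 - ‖f w‖ := by
    rw [add_zero, hωw, ← ofReal_one, ← ofReal_sub, norm_real, Real.norm_eq_abs, abs_sub_comm,
      abs_of_nonneg (by linarith)]
  have hc : 1 - ‖f c‖ ≤ ‖ω * f (w + (c - w)) - 1‖ := by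
    rw [add_sub_cancel, norm_sub_rev]
    calc 1 - ‖f c‖ = ‖(1 : ℂ)‖ - ‖ω * f c‖ := by simp [hω]
      _ ≤ _ := norm_sub_norm_le _ _
  rw [h0] at key
  set ρ := ‖c - w‖
  have hρ : 0 ≤ ρ := norm_nonneg _
  have hden : 0 < 3 * R / 4 - ρ := by linarith
  have h1 : 2 * ε * ρ / (3 * R / 4 - ρ) ≤ ε := by
    rw [div_le_iff₀ hden]; nlinarith
  have h2 : (1 - ‖f w‖) * (3 * R / 4 + ρ) / (3 * R / 4 - ρ) ≤ 2 * (1 - ‖f w‖) := by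
    rw [div_le_iff₀ hden]; nlinarith
  linarith

theorem summable_wToFun {β : ℕ → ℝ} (hβ : ∀ n, 1 ≤ β n) (f : WH2) {z : ℂ} (hz : z ∈ uDisc) :
    Summable fun n : ℕ => (f n / (β n : ℂ)) * z ^ n := by
  refine Summable.of_norm_bounded
    ((summable_geometric_of_lt_one (norm_nonneg z) (mem_uDisc.1 hz)).mul_left ‖f‖) fun n => ?_
  rw [norm_mul, norm_pow, norm_div, norm_real, Real.norm_of_nonneg (by linarith [hβ n])]
  gcongr
  exact (div_le_self (norm_nonneg _) (hβ n)).trans (lp.norm_apply_le_norm (by simp) f n)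

theorem isDiscSeries_wToFun {β : ℕ → ℝ} (hβ : ∀ n, 1 ≤ β n) (f : WH2) :
    IsDiscSeries (fun n => f n / (β n : ℂ)) (wToFun β f) :=
  fun _ hz => (summable_wToFun hβ f hz).hasSum

/-- Evaluation at a point of the disc is bounded when the weights are at least `1`. -/
theorem exists_evalCLM {β : ℕ → ℝ} (hβ : ∀ n, 1 ≤ β n) {z : ℂ} (hz : z ∈ uDisc) :
    ∃ L : WH2 →L[ℂ] ℂ, ∀ f, L f = wToFun β f z := by
  refine ⟨LinearMap.mkContinuous
    { toFun := fun f => wToFun β f z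
      map_add' := fun f g => ?_
      map_smul' := fun c f => ?_ } (∑' n : ℕ, ‖z‖ ^ n) fun f => ?_, fun f => rfl⟩
  · simp only [wToFun, lp.coeFn_add, Pi.add_apply, add_div, add_mul]
    exact (summable_wToFun hβ f hz).tsum_add (summable_wToFun hβ g hz)
  · simp only [wToFun, lp.coeFn_smul, Pi.smul_apply, smul_eq_mul, RingHom.id_apply]
    rw [← tsum_mul_left]
    exact tsum_congr fun n => by ring
  · have hg := summable_geometric_of_lt_one (norm_nonneg z) (mem_uDisc.1 hz)
    change ‖wToFun β f z‖ ≤ _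
    rw [mul_comm, ← tsum_mul_left]
    refine tsum_of_norm_bounded (hg.mul_left ‖f‖).hasSum fun n => ?_
    rw [norm_mul, norm_pow, norm_div, norm_real, Real.norm_of_nonneg (by linarith [hβ n])]
    gcongr
    exact (div_le_self (norm_nonneg _) (hβ n)).trans (lp.norm_apply_le_norm (by simp) f n)

theorem wToFun_single (β : ℕ → ℝ) (n : ℕ) (z : ℂ) :
    wToFun β (lp.single 2 n (1 : ℂ)) z = z ^ n / β n := by
  rw [wToFun, tsum_eq_single n]
  · simp [div_eq_mul_inv, mul_comm]
  · intro m hm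
    simp [hm]

theorem exists_ball_subset_sector {θ : ℝ} (hθ : 0 < θ) :
    ∃ δ ∈ Ioo (0 : ℝ) 1, ∀ t : ℝ, 0 < t → ball (t : ℂ) (t * δ) ⊆ Sector θ \ {0} := by
  have hnhds : {z : ℂ | |arg z| < θ} ∈ 𝓝 (1 : ℂ) := by
    have hc : ContinuousAt (fun z : ℂ => |arg z|) 1 := (continuousAt_arg (by simp)).abs
    exact hc.eventually_lt_const (by simpa using hθ)
  obtain ⟨δ, hδ, hball⟩ := Metric.mem_nhds_iff.1 hnhds
  refine ⟨min δ (1 / 2), ⟨by positivity, by linarith [min_le_right δ (1 / 2)]⟩, ?_⟩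
  intro t ht z hz
  rw [mem_ball_iff_norm] at hz
  have ht' : (t : ℂ) ≠ 0 := by exact_mod_cast ht.ne'
  have hz1 : ‖z / t - 1‖ < min δ (1 / 2) := by
    rw [div_sub_one ht', norm_div, norm_real, Real.norm_of_nonneg ht.le, div_lt_iff₀ ht]
    linarith
  refine ⟨?_, ?_⟩
  · have := hball (mem_ball_iff_norm.2 (hz1.trans_le (min_le_left _ _)))
    rw [mem_ofPred_eq, ← arg_real_mul _ ht, mul_div_cancel₀ _ ht'] at this
    exact this
  · rintro rfl
    have := hz1.trans_le (min_le_right _ _)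
    norm_num at this

/-- A real number whose powers grow at most linearly is at most `1`. -/
theorem le_one_of_pow_le_mul {x M : ℝ} (h : ∀ n : ℕ, x ^ n ≤ M * (n + 1)) : x ≤ 1 := by
  by_contra! hx
  have h1 : Tendsto (fun n : ℕ => ((n : ℝ) + 1) / x ^ n) atTop (𝓝 0) := by
    have h2 := tendsto_pow_const_div_const_pow_of_one_lt 1 hx
    have h3 := tendsto_pow_const_div_const_pow_of_one_lt 0 hx
    simpa [add_div] using h2.add h3
  have h2 := h1.const_mul M
  rw [mul_zero] at h2
  obtain ⟨n, hn⟩ := (h2.eventually_lt_const one_pos).exists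
  have hp : 0 < x ^ n := by positivity
  rw [← mul_div_assoc, div_lt_one hp] at hn
  linarith [h n]

/-- The orbit maps of an analytic semigroup of composition operators extend holomorphically
to a sector, with values in the closed unit disc. -/
theorem exists_holomorphic_orbit {β : ℕ → ℝ} (hβ : ∀ n, 1 ≤ β n) (hβ' : ∀ n : ℕ, β n ≤ n + 1)
    {φ : ℝ → ℂ → ℂ} {T : ℝ → WH2 →L[ℂ] WH2}
    (hrep : ∀ t : ℝ, 0 ≤ t → RepresentsComp β (T t) (φ t))
    {θ : ℝ} {Te : ℂ → WH2 →L[ℂ] WH2} (hTe : IsAnalyticExtension T θ Te)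
    {t R : ℝ} (ht : 0 < t) (hR : 0 < R) (hball : ball (t : ℂ) R ⊆ Sector θ \ {0})
    {z : ℂ} (hz : z ∈ uDisc) :
    ∃ F : ℂ → ℂ, DifferentiableOn ℂ F (ball (t : ℂ) R) ∧
      (∀ x ∈ ball (t : ℂ) R, ‖F x‖ ≤ 1) ∧ ∀ s : ℝ, 0 < s → F s = φ s z := by
  obtain ⟨hext, hdiff, -⟩ := hTe
  obtain ⟨L, hL⟩ := exists_evalCLM hβ hz
  have hβ0 : ∀ n, (β n : ℂ) ≠ 0 := fun n => by
    have := hβ n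
    exact_mod_cast (by linarith : β n ≠ 0)
  let F : ℕ → ℂ → ℂ := fun n x => β n * L (Te x (lp.single 2 n (1 : ℂ)))
  have hF : ∀ n, DifferentiableOn ℂ (F n) (ball (t : ℂ) R) := fun n =>
    (L.differentiable.comp_differentiableOn
      ((hdiff.mono hball).clm_apply (differentiableOn_const _))).const_mul _
  have hreal : ∀ n, ∀ s : ℝ, 0 < s → F n s = φ s z ^ n := fun n s hs => by
    simp only [F, hext s hs.le, hL, (hrep s hs.le).2.2 _ z hz, wToFun_single]
    field_simp [hβ0 n]
  have hpow : ∀ n, EqOn (F n) (fun x => F 1 x ^ n) (ball (t : ℂ) R) := fun n => by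
    refine ((hF n).analyticOnNhd isOpen_ball).eqOn_of_preconnected_of_frequently_eq
      (((hF 1).pow n).analyticOnNhd isOpen_ball) (convex_ball _ _).isPreconnected
      (mem_ball_self hR) ?_
    have hten : Tendsto (fun s : ℝ => (s : ℂ)) (𝓝[≠] t) (𝓝[≠] (t : ℂ)) :=
      continuous_ofReal.continuousWithinAt.tendsto_nhdsWithin fun s hs => by simpa using hs
    refine hten.frequently (Eventually.frequently ?_)
    filter_upwards [mem_nhdsWithin_of_mem_nhds (Ioi_mem_nhds ht)] with s hs
    simp [hreal _ s hs]
  refine ⟨F 1, hF 1, fun x hx => ?_, fun s hs => by simp [hreal 1 s hs]⟩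
  refine le_one_of_pow_le_mul (M := ‖L‖ * ‖Te x‖) fun n => ?_
  rw [← norm_pow, ← show F n x = F 1 x ^ n from hpow n hx]
  calc ‖F n x‖ = β n * ‖L (Te x (lp.single 2 n (1 : ℂ)))‖ := by
        simp [F, abs_of_nonneg (zero_le_one.trans (hβ n))]
    _ ≤ (n + 1) * (‖L‖ * (‖Te x‖ * ‖(lp.single 2 n (1 : ℂ) : WH2)‖)) := by
        gcongr
        · exact hβ' n
        · exact (L.le_opNorm _).trans (by gcongr; exact (Te x).le_opNorm _)
    _ = ‖L‖ * ‖Te x‖ * (n + 1) := by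
        rw [lp.norm_single (by norm_num), norm_one]; ring

/-- Strict contractivity of the symbol propagates to all positive times. -/
theorem supNormLtOne_of_exists {β : ℕ → ℝ} (hβ : ∀ n, 1 ≤ β n) (hβ' : ∀ n : ℕ, β n ≤ n + 1)
    {φ : ℝ → ℂ → ℂ} (hφ : IsSemiflow φ) {T : ℝ → WH2 →L[ℂ] WH2}
    (hrep : ∀ t : ℝ, 0 ≤ t → RepresentsComp β (T t) (φ t)) (han : IsAnalyticSemigroup T)
    {t₀ : ℝ} (ht₀ : 0 < t₀) (h₀ : SupNormLtOne (φ t₀)) {t : ℝ} (ht : 0 < t) :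
    SupNormLtOne (φ t) := by
  obtain ⟨θ, hθ, Te, hTe⟩ := han
  obtain ⟨δ, hδ, hball⟩ := exists_ball_subset_sector hθ.1
  have step : ∀ s : ℝ, 0 < s → SupNormLtOne (φ s) → SupNormLtOne (φ (s * (1 - δ / 4))) := by
    rintro s hs ⟨r, hr, hrs⟩
    refine ⟨1 - (1 - r) / 2, by linarith, fun z hz => ?_⟩
    have hsδ : 0 < s * δ := mul_pos hs hδ.1
    obtain ⟨F, hF, hF1, hFs⟩ := exists_holomorphic_orbit hβ hβ' hrep hTe hs hsδ (hball s hs) hz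
    have hs' : 0 < s * (1 - δ / 4) := mul_pos hs (by linarith [hδ.2])
    have := one_sub_norm_le_two_mul (w := ((s * (1 - δ / 4) : ℝ) : ℂ)) hsδ hF hF1 (by
      rw [← ofReal_sub, norm_real, Real.norm_eq_abs, abs_le]
      constructor <;> linarith)
    rw [hFs _ hs, hFs _ hs'] at this
    linarith [hrs z hz]
  have iter : ∀ n : ℕ, SupNormLtOne (φ (t₀ * (1 - δ / 4) ^ n)) := by
    intro n
    induction n with
    | zero => simpa using h₀
    | succ n ih =>
      rw [pow_succ, ← mul_assoc]
      exact step _ (mul_pos ht₀ (pow_pos (by linarith [hδ.2]) n)) ih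
  have hlim : Tendsto (fun n : ℕ => t₀ * (1 - δ / 4) ^ n) atTop (𝓝 0) := by
    simpa using (tendsto_pow_atTop_nhds_zero_of_lt_one (by linarith [hδ.2])
      (by linarith [hδ.1] : 1 - δ / 4 < 1)).const_mul t₀
  obtain ⟨n, hn⟩ := (hlim.eventually_lt_const ht).exists
  have hs : 0 < t₀ * (1 - δ / 4) ^ n := mul_pos ht₀ (pow_pos (by linarith [hδ.2]) n)
  obtain ⟨r, hr, hb⟩ := iter n
  refine ⟨r, hr, fun z hz => ?_⟩
  have h1 := hφ.2.2.1 _ (t - t₀ * (1 - δ / 4) ^ n) hs.le (by linarith) z hz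
  rw [add_sub_cancel] at h1
  rw [h1]
  exact hb _ ((hφ.2.1 _ (by linarith)).2 hz)

theorem IsDiscSeries.congr {a : ℕ → ℂ} {f g : ℂ → ℂ} (h : IsDiscSeries a f)
    (hfg : EqOn f g uDisc) : IsDiscSeries a g :=
  fun z hz => hfg hz ▸ h z hz

theorem IsDiscSeries.sum_sq_le_of_norm_le {b : ℕ → ℂ} {g : ℂ → ℂ} (hg : IsDiscSeries b g)
    {C : ℝ} (hle : ∀ z ∈ uDisc, ‖g z‖ ≤ C) (K : Finset ℕ) :
    ∑ k ∈ K, ‖b k‖ ^ 2 ≤ C ^ 2 := by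
  have hone : IsDiscSeries (Pi.single 0 1) fun _ => 1 := fun z _ => by
    convert hasSum_single (f := fun k : ℕ => (Pi.single 0 1 : ℕ → ℂ) k * z ^ k) 0 ?_ using 1
    · simp
    · intro k hk
      simp [hk]
  have hlim : Tendsto (fun s : ℝ => ∑ k ∈ K, ‖b k‖ ^ 2 * (s ^ 2) ^ k) (𝓝[<] 1)
      (𝓝 (∑ k ∈ K, ‖b k‖ ^ 2)) := by
    have hc : Continuous fun s : ℝ => ∑ k ∈ K, ‖b k‖ ^ 2 * (s ^ 2) ^ k := by fun_prop
    simpa using (hc.tendsto 1).mono_left nhdsWithin_le_nhds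
  refine le_of_tendsto hlim ?_
  filter_upwards [Ioo_mem_nhdsLT zero_lt_one] with s hs
  obtain ⟨A, B, hA, hB, hAB⟩ := hone.hasSum_sq_le hg (by simpa using hle) hs.1.le hs.2
  have hA1 : A = 1 := by
    refine hA.unique ?_
    convert hasSum_single
      (f := fun k : ℕ => ‖(Pi.single 0 1 : ℕ → ℂ) k‖ ^ 2 * (s ^ 2) ^ k) 0 ?_ using 1
    · simp
    · intro k hk
      simp [hk]
  rw [hA1, mul_one] at hAB
  exact (sum_le_hasSum K (fun k _ => by positivity) hB).trans hAB

theorem wToFun_apply_single {β : ℕ → ℝ} {T : WH2 →L[ℂ] WH2} {φ : ℂ → ℂ}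
    (h : RepresentsComp β T φ) (n : ℕ) :
    EqOn (wToFun β (T (lp.single 2 n (1 : ℂ)))) (fun z => φ z ^ n / β n) uDisc := fun z hz => by
  rw [h.2.2 _ z hz, wToFun_single]

/-- Symbols of sup norm less than one induce Hilbert-Schmidt operators on the Hardy space. -/
theorem isHilbertSchmidt_hardy {T : WH2 →L[ℂ] WH2} {φ : ℂ → ℂ} (h : RepresentsComp hardyW T φ)
    (hφ : SupNormLtOne φ) : IsHilbertSchmidt T := by
  obtain ⟨r, hr, hb⟩ := hφ
  have hr0 : 0 ≤ r := (norm_nonneg _).trans (hb 0 (by simp [mem_uDisc]))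
  refine Summable.of_nonneg_of_le (fun n => by positivity) (fun n => ?_)
    (summable_geometric_of_lt_one (sq_nonneg r) (by nlinarith))
  rw [← pow_mul, mul_comm, pow_mul]
  gcongr
  refine lp.norm_le_of_forall_sum_le (by norm_num) (by positivity) fun K => ?_
  have hs := (isDiscSeries_wToFun (β := hardyW) (fun _ => le_rfl)
    (T (lp.single 2 n (1 : ℂ)))).congr (wToFun_apply_single h n)
  have := hs.sum_sq_le_of_norm_le (C := r ^ n) (fun z hz => by
    simp only [hardyW, ofReal_one, div_one, norm_pow]
    gcongr
    exact hb z hz) K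
  simpa [hardyW] using this

theorem one_le_dirichletW (n : ℕ) : 1 ≤ dirichletW n := by
  unfold dirichletW
  split_ifs with h
  · exact le_rfl
  · rw [Real.one_le_sqrt]
    exact_mod_cast Nat.one_le_iff_ne_zero.2 h

theorem dirichletW_le (n : ℕ) : dirichletW n ≤ n + 1 := by
  unfold dirichletW
  split_ifs with h
  · simp
  · rw [Real.sqrt_le_left (by positivity)]
    nlinarith [(Nat.cast_nonneg n : (0 : ℝ) ≤ n)]

theorem sq_dirichletW_succ (k : ℕ) : dirichletW (k + 1) ^ 2 = k + 1 := by
  rw [dirichletW, if_neg k.succ_ne_zero, Real.sq_sqrt (by positivity)]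
  push_cast
  rfl

/-- The Dirichlet coefficients of a function are, up to the Bergman weights, those of its
derivative. -/
theorem dirichlet_deriv_coeff (g : WH2) (k : ℕ) :
    ‖(k + 1 : ℂ) * (g (k + 1) / (dirichletW (k + 1) : ℂ))‖ ^ 2 / (k + 1) = ‖g (k + 1)‖ ^ 2 := by
  have hk : (0 : ℝ) < k + 1 := by positivity
  have : ‖(k + 1 : ℂ)‖ = k + 1 := by
    rw [← Nat.cast_succ, norm_natCast]
    push_cast
    rfl
  rw [norm_mul, norm_div, this, norm_real, mul_pow, div_pow, Real.norm_eq_abs, sq_abs,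
    sq_dirichletW_succ]
  field_simp

theorem WH2.hasSum_norm_sq (g : WH2) : HasSum (fun k => ‖g k‖ ^ 2) (‖g‖ ^ 2) := by
  simpa using lp.hasSum_norm (p := 2) (by norm_num) g

/-- Symbols of sup norm less than one induce Hilbert-Schmidt operators on the Dirichlet space. -/
theorem isHilbertSchmidt_dirichlet {T : WH2 →L[ℂ] WH2} {φ : ℂ → ℂ}
    (h : RepresentsComp dirichletW T φ) (hφ : SupNormLtOne φ) : IsHilbertSchmidt T := by
  obtain ⟨r, hr, hb⟩ := hφ
  have h0 : (0 : ℂ) ∈ uDisc := by simp [mem_uDisc]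
  have hr0 : 0 ≤ r := (norm_nonneg _).trans (hb 0 h0)
  have hr1 : ‖r ^ 2‖ < 1 := by
    rw [Real.norm_of_nonneg (sq_nonneg r)]
    nlinarith
  set c : WH2 := T (lp.single 2 1 (1 : ℂ)) with hc
  have hφd : ∀ z ∈ uDisc, DifferentiableAt ℂ φ z := fun z hz =>
    h.1.differentiableAt (isOpen_ball.mem_nhds hz)
  have hderiv : ∀ n, EqOn (deriv (wToFun dirichletW (T (lp.single 2 n (1 : ℂ)))))
      (fun z => n * φ z ^ (n - 1) * deriv φ z / dirichletW n) uDisc := fun n z hz => by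
    have he : wToFun dirichletW (T (lp.single 2 n (1 : ℂ))) =ᶠ[𝓝 z]
        fun z => φ z ^ n / dirichletW n :=
      (wToFun_apply_single h n).eventuallyEq_of_mem (isOpen_ball.mem_nhds hz)
    rw [he.deriv_eq]
    exact (((hφd z hz).hasDerivAt.pow n).div_const _).deriv
  have hser : ∀ n, IsDiscSeries _ (fun z => n * φ z ^ (n - 1) * deriv φ z / dirichletW n) :=
    fun n => (isDiscSeries_wToFun one_le_dirichletW
      (T (lp.single 2 n (1 : ℂ)))).deriv.congr (hderiv n)
  have hser1 : IsDiscSeries (fun k => (k + 1 : ℂ) * (c (k + 1) / (dirichletW (k + 1) : ℂ)))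
      (deriv φ) := (hser 1).congr fun z _ => by simp [dirichletW]
  have hcsum : HasSum (fun k => ‖c (k + 1)‖ ^ 2) (‖c‖ ^ 2 - ‖c 0‖ ^ 2) := by
    simpa using (hasSum_nat_add_iff' 1).2 c.hasSum_norm_sq
  have hbound : ∀ n : ℕ, ‖T (lp.single 2 (n + 1) (1 : ℂ))‖ ^ 2 ≤
      (r ^ 2) ^ (n + 1) + ((n + 1) * r ^ n) ^ 2 * ‖c‖ ^ 2 := fun n => by
    set g : WH2 := T (lp.single 2 (n + 1) (1 : ℂ)) with hg
    have hle : ∀ z ∈ uDisc, ‖((n + 1 : ℕ) : ℂ) * φ z ^ (n + 1 - 1) * deriv φ z /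
        dirichletW (n + 1)‖ ≤ (n + 1) * r ^ n * ‖deriv φ z‖ := fun z hz => by
      rw [norm_div, norm_real, Real.norm_of_nonneg (zero_le_one.trans (one_le_dirichletW _))]
      refine (div_le_self (norm_nonneg _) (one_le_dirichletW _)).trans ?_
      rw [norm_mul, norm_mul, norm_pow, norm_natCast, Nat.add_sub_cancel]
      push_cast
      gcongr
      exact hb z hz
    obtain ⟨B, hB, hBle⟩ := sum_div_succ_le
      (c := fun k => ‖(k + 1 : ℂ) * (g (k + 1) / (dirichletW (k + 1) : ℂ))‖ ^ 2)
      (d := fun k => ‖(k + 1 : ℂ) * (c (k + 1) / (dirichletW (k + 1) : ℂ))‖ ^ 2)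
      (fun _ => sq_nonneg _) (fun _ => sq_nonneg _) (sq_nonneg ((n + 1) * r ^ n))
      (fun x hx => by
        have := hser1.hasSum_sq_le (hser (n + 1)) hle (Real.sqrt_nonneg x)
          (by rw [Real.sqrt_lt' one_pos]; simpa using hx.2)
        simpa only [Real.sq_sqrt hx.1.le] using this)
      (by simpa only [dirichlet_deriv_coeff] using hcsum)
    simp only [dirichlet_deriv_coeff] at hB
    have hgB : ‖g‖ ^ 2 - ‖g 0‖ ^ 2 = B := by
      refine HasSum.unique ?_ hB
      simpa using (hasSum_nat_add_iff' 1).2 g.hasSum_norm_sq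
    have hg0 : ‖g 0‖ ≤ r ^ (n + 1) := by
      have h1 : wToFun dirichletW g 0 = g 0 := by
        rw [wToFun, tsum_eq_single 0]
        · simp [dirichletW]
        · intro m hm
          simp [hm]
      rw [← h1, hg, wToFun_apply_single h (n + 1) h0, norm_div, norm_real,
        Real.norm_of_nonneg (zero_le_one.trans (one_le_dirichletW _))]
      refine (div_le_self (norm_nonneg _) (one_le_dirichletW _)).trans ?_
      rw [norm_pow]
      gcongr
      exact hb 0 h0
    have hg0' : ‖g 0‖ ^ 2 ≤ (r ^ 2) ^ (n + 1) := by
      rw [← pow_mul, mul_comm, pow_mul]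
      gcongr
    have hmul : ((n + 1) * r ^ n) ^ 2 * (‖c‖ ^ 2 - ‖c 0‖ ^ 2) ≤
        ((n + 1) * r ^ n) ^ 2 * ‖c‖ ^ 2 := by
      gcongr
      linarith [sq_nonneg ‖c 0‖]
    linarith
  rw [IsHilbertSchmidt, ← summable_nat_add_iff 1]
  refine Summable.of_nonneg_of_le (fun n => by positivity) hbound (Summable.add ?_ ?_)
  · exact (summable_nat_add_iff 1).2 (summable_geometric_of_norm_lt_one hr1)
  · refine Summable.mul_right _ ?_
    have h2 := summable_pow_mul_geometric_of_norm_lt_one 2 hr1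
    have h1 := summable_pow_mul_geometric_of_norm_lt_one 1 hr1
    have h0 := summable_pow_mul_geometric_of_norm_lt_one 0 hr1
    refine ((h2.add (h1.mul_left 2)).add h0).congr fun n => ?_
    ring

/-- For an immediately compact analytic semigroup of composition
operators on `H²(𝔻)` or `𝒟`: `‖φ_{t₀}‖_∞ < 1` for some `t₀ > 0` iff
`‖φ_t‖_∞ < 1` for all `t > 0`; and in that case the semigroup is immediately
trace-class. -/
theorem statement17 (β : ℕ → ℝ) (hβ : β = hardyW ∨ β = dirichletW)
    (φ : ℝ → ℂ → ℂ) (hφ : IsSemiflow φ)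
    (T : ℝ → WH2 →L[ℂ] WH2) (hT : IsC0Semigroup T)
    (hrep : ∀ t : ℝ, 0 ≤ t → RepresentsComp β (T t) (φ t))
    (han : IsAnalyticSemigroup T)
    (hcomp : ImmediatelyCompact T) :
    ((∃ t₀ : ℝ, 0 < t₀ ∧ SupNormLtOne (φ t₀)) ↔
        ∀ t : ℝ, 0 < t → SupNormLtOne (φ t)) ∧
      ((∃ t₀ : ℝ, 0 < t₀ ∧ SupNormLtOne (φ t₀)) →
        ∀ t : ℝ, 0 < t → IsTraceClass (T t)) := by
  have hβ1 : ∀ n, 1 ≤ β n := by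
    rcases hβ with rfl | rfl
    exacts [fun _ => le_rfl, one_le_dirichletW]
  have hβ2 : ∀ n : ℕ, β n ≤ n + 1 := by
    rcases hβ with rfl | rfl
    exacts [fun n => by simp [hardyW], dirichletW_le]
  have hall : (∃ t₀ : ℝ, 0 < t₀ ∧ SupNormLtOne (φ t₀)) →
      ∀ t : ℝ, 0 < t → SupNormLtOne (φ t) := fun ⟨_, ht₀, h₀⟩ _ ht =>
    supNormLtOne_of_exists hβ1 hβ2 hφ hrep han ht₀ h₀ ht
  refine ⟨⟨hall, fun h => ⟨1, one_pos, h 1 one_pos⟩⟩, fun h t ht => ?_⟩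
  have hhalf : 0 < t / 2 := half_pos ht
  have hHS : IsHilbertSchmidt (T (t / 2)) := by
    have hr := hrep _ hhalf.le
    rcases hβ with rfl | rfl
    exacts [isHilbertSchmidt_hardy hr (hall h _ hhalf),
      isHilbertSchmidt_dirichlet hr (hall h _ hhalf)]
  refine ⟨_, _, hHS, hHS, ?_⟩
  rw [← hT.2.1 _ _ hhalf.le hhalf.le, add_halves]
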